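/- Let S_a and S_b be compact topological spaces and let v = (v_a, v_b) : S_a × S_b → ℝ² be continuous for the product topology. Suppose the game whose preferences are given by strict payoff comparison (player a prefers a profile with strictly larger first coordinate of v, player b one with strictly larger second coordinate) contains no forbidden pattern. Then for every ε > 0 the collective ε-improvement relation terminates: there is no infinite sequence of profiles in which each step is an ε-improvement by some player; consequently every maximal ε-improvement sequence is finite and ends at an ε-Nash equilibrium. -/

import Mathlib

section GamePrelims

variable {Sa Sb O : Type*}

/-- Preference of player `p` (`true` = player a, `false` = player b). -/
def PrefOf (pa pb : O → O → Prop) (p : Bool) : O → O → Prop := cond p pa pb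

/-- `o ⪯_p o'` means `¬ (o' ≺_p o)`. -/
def Ple (pa pb : O → O → Prop) (p : Bool) (o o' : O) : Prop := ¬ PrefOf pa pb p o' o

/-- `o ∼_p o'`. -/
def Psim (pa pb : O → O → Prop) (p : Bool) (o o' : O) : Prop :=
  Ple pa pb p o o' ∧ Ple pa pb p o' o

/-- Player `p` can convert `s` to `s'` (the other player's component is unchanged). -/
def Conv (p : Bool) (s s' : Sa × Sb) : Prop := cond p (s.2 = s'.2) (s.1 = s'.1)

/-- Improvement step of player `p`. -/
def Impr (v : Sa × Sb → O) (pa pb : O → O → Prop) (p : Bool) (s s' : Sa × Sb) : Prop :=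
  Conv p s s' ∧ PrefOf pa pb p (v s) (v s')

/-- Collective improvement. -/
def Step (v : Sa × Sb → O) (pa pb : O → O → Prop) (s s' : Sa × Sb) : Prop :=
  ∃ p, Impr v pa pb p s s'

/-- Nash equilibrium. -/
def IsNE (v : Sa × Sb → O) (pa pb : O → O → Prop) (s : Sa × Sb) : Prop :=
  ∀ p s', ¬ Impr v pa pb p s s'

/-- Maximising improvement step of player `p`. -/
def MaxImpr (v : Sa × Sb → O) (pa pb : O → O → Prop) (p : Bool) (s s' : Sa × Sb) : Prop :=
  Impr v pa pb p s s' ∧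
    cond p (∀ t : Sa, ¬ pa (v s') (v (t, s.2))) (∀ t : Sb, ¬ pb (v s') (v (s.1, t)))

/-- Rectangle of profiles `w x y z` anchored at player `p`:
`w` and `x` differ exactly in `p`'s component, `x` and `y` in the other player's component,
`y` and `z` in `p`'s component, and `z` and `w` in the other player's component. -/
def Rect (p : Bool) (w x y z : Sa × Sb) : Prop :=
  cond p
    (w.2 = x.2 ∧ x.1 = y.1 ∧ y.2 = z.2 ∧ z.1 = w.1 ∧ w.1 ≠ x.1 ∧ x.2 ≠ y.2)
    (w.1 = x.1 ∧ x.2 = y.2 ∧ y.1 = z.1 ∧ z.2 = w.2 ∧ w.2 ≠ x.2 ∧ x.1 ≠ y.1)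

/-- Elementary cycle. -/
def IsEC (v : Sa × Sb → O) (pa pb : O → O → Prop) (p : Bool) (w x y z : Sa × Sb) : Prop :=
  Rect p w x y z ∧ Impr v pa pb p w x ∧ Impr v pa pb (!p) x y ∧
    Impr v pa pb p y z ∧ Impr v pa pb (!p) z w

/-- Pareto-useful bypass. -/
def IsPUB (v : Sa × Sb → O) (pa pb : O → O → Prop) (p : Bool) (w x y z : Sa × Sb) : Prop :=
  Rect p w x y z ∧ Impr v pa pb p w x ∧ Impr v pa pb (!p) x y ∧ Impr v pa pb p y z ∧
    Ple pa pb (!p) (v w) (v z) ∧ PrefOf pa pb p (v w) (v z)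

/-- Pareto-useless confluence. -/
def IsPUC (v : Sa × Sb → O) (pa pb : O → O → Prop) (p : Bool) (w x y z : Sa × Sb) : Prop :=
  Rect p w x y z ∧ Impr v pa pb p w x ∧ Impr v pa pb (!p) x y ∧ Impr v pa pb (!p) w z ∧
    Impr v pa pb p z y ∧ PrefOf pa pb (!p) (v y) (v w)

/-- Strict weak order. -/
def IsSWO (r : O → O → Prop) : Prop :=
  Irreflexive r ∧ Transitive r ∧ Transitive (fun x y => ¬ r x y ∧ ¬ r y x)

/-- Pseudo-transitivity. -/
def PseudoTransitive (r : O → O → Prop) : Prop :=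
  (∀ x y z, r x y → ¬ r z y → r x z) ∧ (∀ x y z, ¬ r y x → r y z → r x z)

end GamePrelims

/-- `ε`-improvement step of player `p` in a game with real-valued payoffs. -/
def EImpr {Sa Sb : Type*} (v : Sa × Sb → ℝ × ℝ) (ε : ℝ) (p : Bool) (s s' : Sa × Sb) : Prop :=
  Conv p s s' ∧ cond p ((v s).1 + ε < (v s').1) ((v s).2 + ε < (v s').2)

section ClosedWalks

variable {X : Type*}

/-- `f` runs forever around a closed `S`-walk of length `n`. -/
def ClosedWalk (S : X → X → Prop) (n : ℕ) (f : ℕ → X) : Prop :=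
  0 < n ∧ (∀ k, f (k + n) = f k) ∧ ∀ k, S (f k) (f (k + 1))

theorem exists_closedWalk_of_eq {S : X → X → Prop} {m : ℕ} (hm : 0 < m) (g : ℕ → X)
    (hg : ∀ k < m, S (g k) (g (k + 1))) (hclose : g m = g 0) : ∃ f, ClosedWalk S m f := by
  refine ⟨fun k => g (k % m), hm, fun k => by simp, fun k => ?_⟩
  have hk := Nat.mod_lt k hm
  have hstep := hg (k % m) hk
  have hmod : (k + 1) % m = (k % m + 1) % m := by simp
  change S (g (k % m)) (g ((k + 1) % m))
  rcases Nat.lt_or_ge (k % m + 1) m with h | h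
  · rwa [hmod, Nat.mod_eq_of_lt h]
  · have h' : k % m + 1 = m := by omega
    rw [hmod, h', Nat.mod_self, ← hclose]
    rwa [h'] at hstep

theorem ClosedWalk.exists_skip_one {S : X → X → Prop} {n : ℕ} {f : ℕ → X}
    (hf : ClosedWalk S n f) (hn : 2 ≤ n) {t : ℕ} (h : S (f t) (f (t + 2))) :
    ∃ g, ClosedWalk S (n - 1) g := by
  refine exists_closedWalk_of_eq (by omega) (fun k => if k = 0 then f t else f (t + 1 + k))
    (fun k _ => ?_) ?_
  · rcases Nat.eq_zero_or_pos k with rfl | hk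
    · simpa using h
    · simpa [hk.ne', Nat.add_assoc] using hf.2.2 (t + 1 + k)
  · have h0 : n - 1 ≠ 0 := by omega
    have h1 : t + 1 + (n - 1) = t + n := by omega
    simp only [h0, if_false, if_true, h1, hf.2.1]

theorem ClosedWalk.exists_skip_two {S : X → X → Prop} {n : ℕ} {f : ℕ → X}
    (hf : ClosedWalk S n f) (hn : 4 ≤ n) {t : ℕ} {z : X} (h : S (f t) z)
    (h' : S z (f (t + 4))) : ∃ g, ClosedWalk S (n - 2) g := by
  refine exists_closedWalk_of_eq (by omega)
    (fun k => if k = 0 then f t else if k = 1 then z else f (t + 2 + k)) (fun k _ => ?_) ?_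
  · rcases k with _ | _ | k
    · simpa using h
    · simpa using h'
    · simpa [Nat.add_assoc] using hf.2.2 (t + 2 + (k + 2))
  · have h0 : n - 2 ≠ 0 := by omega
    have h1 : n - 2 ≠ 1 := by omega
    have h2 : t + 2 + (n - 2) = t + n := by omega
    simp only [h0, h1, if_false, if_true, h2, hf.2.1]

end ClosedWalks

section Payoffs

variable {Sa Sb : Type*}

/-- The payoff of player `p`. -/
def payoff (v : Sa × Sb → ℝ × ℝ) (p : Bool) (s : Sa × Sb) : ℝ := cond p (v s).1 (v s).2

/-- Improvement step of player `p`, phrased through `payoff`. -/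
def Improves (v : Sa × Sb → ℝ × ℝ) (p : Bool) (s t : Sa × Sb) : Prop :=
  Conv p s t ∧ payoff v p s < payoff v p t

/-- The profile with `p`'s component taken from `s` and the other one from `t`. -/
def mix (p : Bool) (s t : Sa × Sb) : Sa × Sb := cond p (s.1, t.2) (t.1, s.2)

theorem Conv.symm {p : Bool} {s s' : Sa × Sb} (h : Conv p s s') : Conv p s' s := by
  cases p <;> exact Eq.symm h

theorem Conv.trans {p : Bool} {s s' s'' : Sa × Sb} (h : Conv p s s') (h' : Conv p s' s'') :
    Conv p s s'' := by
  cases p <;> exact Eq.trans h h'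

theorem Conv.eq_of_not {p : Bool} {s s' : Sa × Sb} (h : Conv p s s') (h' : Conv (!p) s s') :
    s = s' := by
  cases p
  · exact Prod.ext h h'
  · exact Prod.ext h' h

theorem conv_mix_left (p : Bool) (s s' : Sa × Sb) : Conv (!p) s (mix p s s') := by
  cases p <;> rfl

theorem conv_mix_right (p : Bool) (s s' : Sa × Sb) : Conv p (mix p s s') s' := by
  cases p <;> rfl

theorem Improves.not_swap {v : Sa × Sb → ℝ × ℝ} {p : Bool} {s s' : Sa × Sb}
    (h : Improves v p s s') : ¬ Conv (!p) s s' := fun h' => by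
  have hlt := h.2
  rw [h.1.eq_of_not h'] at hlt
  exact lt_irrefl _ hlt

theorem Improves.trans {v : Sa × Sb → ℝ × ℝ} {p : Bool} {s s' s'' : Sa × Sb}
    (h : Improves v p s s') (h' : Improves v p s' s'') : Improves v p s s'' :=
  ⟨h.1.trans h'.1, h.2.trans h'.2⟩

theorem prefOf_iff_payoff_lt (v : Sa × Sb → ℝ × ℝ) (p : Bool) (s s' : Sa × Sb) :
    PrefOf (fun o o' : ℝ × ℝ => o.1 < o'.1) (fun o o' : ℝ × ℝ => o.2 < o'.2) p (v s) (v s') ↔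
      payoff v p s < payoff v p s' := by
  cases p <;> rfl

theorem rect_of_improves {v : Sa × Sb → ℝ × ℝ} {p : Bool} {w x y z : Sa × Sb}
    (hwx : Improves v p w x) (hxy : Improves v (!p) x y) (hyz : Conv p y z)
    (hzw : Conv (!p) z w) : Rect p w x y z := by
  have hp := hwx.not_swap
  have hq := hxy.not_swap
  cases p
  · exact ⟨hwx.1, hxy.1, hyz, hzw, hp, hq⟩
  · exact ⟨hwx.1, hxy.1, hyz, hzw, hp, hq⟩

/-- No rectangle of the game is an elementary cycle, a Pareto-useful bypass or a Pareto-useless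
confluence. -/
def NoForbiddenPattern (v : Sa × Sb → ℝ × ℝ) : Prop :=
  ∀ (p : Bool) (w x y z : Sa × Sb),
    ¬ (IsEC v (fun o o' : ℝ × ℝ => o.1 < o'.1) (fun o o' : ℝ × ℝ => o.2 < o'.2) p w x y z ∨
       IsPUB v (fun o o' : ℝ × ℝ => o.1 < o'.1) (fun o o' : ℝ × ℝ => o.2 < o'.2) p w x y z ∨
       IsPUC v (fun o o' : ℝ × ℝ => o.1 < o'.1) (fun o o' : ℝ × ℝ => o.2 < o'.2) p w x y z)

variable {v : Sa × Sb → ℝ × ℝ} {p : Bool} {w x y z : Sa × Sb}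

theorem NoForbiddenPattern.not_cycle (hv : NoForbiddenPattern v) (hwx : Improves v p w x)
    (hxy : Improves v (!p) x y) (hyz : Improves v p y z) : ¬ Improves v (!p) z w := by
  intro hzw
  refine hv p w x y z (Or.inl ⟨rect_of_improves hwx hxy hyz.1 hzw.1, ?_, ?_, ?_, ?_⟩) <;>
    rwa [Impr, prefOf_iff_payoff_lt]

theorem NoForbiddenPattern.bypass (hv : NoForbiddenPattern v) (hwx : Improves v p w x)
    (hxy : Improves v (!p) x y) (hyz : Improves v p y z) (hzw : Conv (!p) z w)
    (hle : payoff v (!p) w ≤ payoff v (!p) z) : payoff v p z ≤ payoff v p w := by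
  by_contra! hlt
  refine hv p w x y z (Or.inr (Or.inl
    ⟨rect_of_improves hwx hxy hyz.1 hzw, ?_, ?_, ?_, ?_, ?_⟩))
  · rwa [Impr, prefOf_iff_payoff_lt]
  · rwa [Impr, prefOf_iff_payoff_lt]
  · rwa [Impr, prefOf_iff_payoff_lt]
  · rwa [Ple, prefOf_iff_payoff_lt, not_lt]
  · rwa [prefOf_iff_payoff_lt]

theorem NoForbiddenPattern.confluence (hv : NoForbiddenPattern v) (hwx : Improves v p w x)
    (hxy : Improves v (!p) x y) (hwz : Improves v (!p) w z) (hzy : Improves v p z y) :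
    payoff v (!p) w ≤ payoff v (!p) y := by
  by_contra! hlt
  refine hv p w x y z (Or.inr (Or.inr
    ⟨rect_of_improves hwx hxy hzy.1.symm hwz.1.symm, ?_, ?_, ?_, ?_, ?_⟩)) <;>
    first | rwa [Impr, prefOf_iff_payoff_lt] | rwa [prefOf_iff_payoff_lt]

end Payoffs

section Termination

variable {Sa Sb : Type*} {v : Sa × Sb → ℝ × ℝ}

/-- Improvement step of some player. -/
def Improvement (v : Sa × Sb → ℝ × ℝ) (s t : Sa × Sb) : Prop := ∃ p, Improves v p s t

/-- On a shortest closed walk of improvements, the players move in turn. -/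
theorem ClosedWalk.improves_not {n : ℕ} {f : ℕ → Sa × Sb}
    (hf : ClosedWalk (Improvement v) n f)
    (hmin : ∀ m < n, ¬ ∃ g, ClosedWalk (Improvement v) m g) {t : ℕ} {p : Bool}
    (h : Improves v p (f t) (f (t + 1))) : Improves v (!p) (f (t + 1)) (f (t + 2)) := by
  have hn : 2 ≤ n := by
    by_contra! hlt
    obtain rfl : n = 1 := by have := hf.1; omega
    have hlt := h.2
    rw [hf.2.1 t] at hlt
    exact lt_irrefl _ hlt
  obtain ⟨q, hq⟩ := hf.2.2 (t + 1)
  rcases eq_or_ne q p with rfl | hne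
  · exact absurd (hf.exists_skip_one hn ⟨q, h.trans hq⟩) (hmin _ (by omega))
  · rwa [← Bool.eq_not.mpr hne]

theorem ClosedWalk.four_le {n : ℕ} {f : ℕ → Sa × Sb} (hf : ClosedWalk (Improvement v) n f)
    (hmin : ∀ m < n, ¬ ∃ g, ClosedWalk (Improvement v) m g) : 4 ≤ n := by
  by_contra! hlt
  obtain ⟨p, h0⟩ := hf.2.2 0
  have h1 := hf.improves_not hmin h0
  have h2 := hf.improves_not hmin h1
  have h3 := hf.improves_not hmin h2
  have hper := hf.2.1
  have hpos := hf.1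
  interval_cases n
  · have := h0.2
    rw [hper 0] at this
    exact lt_irrefl _ this
  · rw [hper 0] at h1
    exact h0.not_swap h1.1.symm
  · rw [show 0 + 1 + 1 + 1 = 0 + 3 from rfl, show 0 + 1 + 1 + 2 = 1 + 3 from rfl,
      hper, hper, Bool.not_not] at h3
    exact h0.not_swap h3.1

/-- On a shortest closed walk of improvements, the missing corner of the rectangle spanned by two
consecutive steps is either bad for both adjacent movers or good for both of them. -/
theorem ClosedWalk.corner_low_or_high {n : ℕ} {f : ℕ → Sa × Sb} (hv : NoForbiddenPattern v)
    (hf : ClosedWalk (Improvement v) n f)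
    (hmin : ∀ m < n, ¬ ∃ g, ClosedWalk (Improvement v) m g) {k : ℕ} {q : Bool}
    (h : Improves v q (f k) (f (k + 1))) :
    (payoff v q (mix (!q) (f (k + 1)) (f (k + 3))) ≤ payoff v q (f k) ∧
      payoff v (!q) (mix (!q) (f (k + 1)) (f (k + 3))) ≤ payoff v (!q) (f (k + 3))) ∨
    (payoff v (!q) (f (k + 4)) ≤ payoff v (!q) (mix (!q) (f (k + 1)) (f (k + 3))) ∧
      payoff v q (f (k + 1)) ≤ payoff v q (mix (!q) (f (k + 1)) (f (k + 3)))) := by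
  have h1 := hf.improves_not hmin h
  have h2 := hf.improves_not hmin h1
  have h3 := hf.improves_not hmin h2
  simp only [Bool.not_not, Nat.add_assoc, Nat.reduceAdd] at h1 h2 h3
  have hl := conv_mix_left (!q) (f (k + 1)) (f (k + 3))
  have hr := conv_mix_right (!q) (f (k + 1)) (f (k + 3))
  rw [Bool.not_not] at hl
  set z := mix (!q) (f (k + 1)) (f (k + 3))
  have hskip : ¬ (payoff v q (f k) < payoff v q z ∧
      payoff v (!q) z < payoff v (!q) (f (k + 4))) := fun ⟨ha, hb⟩ =>
    hmin (n - 2) (by have := hf.1; omega) (hf.exists_skip_two (hf.four_le hmin)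
      ⟨q, h.1.trans hl, ha⟩ ⟨!q, hr.trans h3.1, hb⟩)
  have hcycle : ¬ (payoff v (!q) (f (k + 3)) < payoff v (!q) z ∧
      payoff v q z < payoff v q (f (k + 1))) := fun ⟨ha, hb⟩ =>
    hv.not_cycle h1 (by rwa [Bool.not_not]) ⟨hr.symm, ha⟩
      (by rw [Bool.not_not]; exact ⟨hl.symm, hb⟩)
  have hq := h.2
  have hp := h3.2
  grind

/-- The corner following step `k` of the walk `f`, made by player `q`, is low: both adjacent
movers get little there. -/
def LowCorner (v : Sa × Sb → ℝ × ℝ) (f : ℕ → Sa × Sb) (q : Bool) (k : ℕ) : Prop :=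
  payoff v q (mix (!q) (f (k + 1)) (f (k + 3))) ≤ payoff v q (f k) ∧
    payoff v (!q) (mix (!q) (f (k + 1)) (f (k + 3))) ≤ payoff v (!q) (f (k + 3))

theorem ClosedWalk.exists_le_payoff {S : Sa × Sb → Sa × Sb → Prop} {n : ℕ} {f : ℕ → Sa × Sb}
    (hf : ClosedWalk S n f) (q : Bool) (k : ℕ) :
    ∃ j, payoff v q (f (k + 2 * j)) ≤ payoff v q (f (k + 2 * j + 2)) := by
  by_contra! h
  have hanti : StrictAnti fun j => payoff v q (f (k + 2 * j)) :=
    strictAnti_nat_of_succ_lt fun j => h j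
  have hlt := hanti hf.1
  have hper : f (k + 2 * n) = f k := by
    rw [two_mul, ← Nat.add_assoc, hf.2.1, hf.2.1]
  simp [hper] at hlt

theorem payoff_mix_le_of_high {f : ℕ → Sa × Sb} (hv : NoForbiddenPattern v) {k : ℕ} {q : Bool}
    (h1 : Improves v (!q) (f (k + 1)) (f (k + 2))) (h2 : Improves v q (f (k + 2)) (f (k + 3)))
    (h3 : Improves v (!q) (f (k + 3)) (f (k + 4)))
    (hp : payoff v (!q) (f (k + 4)) ≤ payoff v (!q) (mix (!q) (f (k + 1)) (f (k + 3))))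
    (hq : payoff v q (f (k + 1)) ≤ payoff v q (mix (!q) (f (k + 1)) (f (k + 3)))) :
    payoff v (!q) (mix (!q) (f (k + 1)) (f (k + 3))) ≤ payoff v (!q) (f (k + 1)) := by
  have hl := conv_mix_left (!q) (f (k + 1)) (f (k + 3))
  exact hv.bypass h1 (by rwa [Bool.not_not])
    ⟨(conv_mix_right _ _ _).symm, h3.2.trans_le hp⟩ hl.symm (by rwa [Bool.not_not])

theorem LowCorner.le_payoff_mix {f : ℕ → Sa × Sb} (hv : NoForbiddenPattern v) {k : ℕ} {q : Bool}
    (hlow : LowCorner v f q k) (h : Improves v q (f k) (f (k + 1)))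
    (h1 : Improves v (!q) (f (k + 1)) (f (k + 2))) (h2 : Improves v q (f (k + 2)) (f (k + 3))) :
    payoff v q (f (k + 3)) ≤ payoff v q (mix (!q) (f (k + 1)) (f (k + 3))) := by
  have hl := conv_mix_left (!q) (f (k + 1)) (f (k + 3))
  rw [Bool.not_not] at hl
  exact hv.bypass ⟨hl.symm, hlow.1.trans_lt h.2⟩ h1 h2 (conv_mix_right _ _ _).symm hlow.2

/-- On a shortest closed walk of improvements, a low corner is followed by a low corner. -/
theorem LowCorner.succ {n : ℕ} {f : ℕ → Sa × Sb} (hv : NoForbiddenPattern v)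
    (hf : ClosedWalk (Improvement v) n f)
    (hmin : ∀ m < n, ¬ ∃ g, ClosedWalk (Improvement v) m g) {k : ℕ} {q : Bool}
    (h : Improves v q (f k) (f (k + 1))) (hlow : LowCorner v f q k) :
    LowCorner v f (!q) (k + 1) := by
  have h1 := hf.improves_not hmin h
  have h2 := hf.improves_not hmin h1
  have h3 := hf.improves_not hmin h2
  have h4 := hf.improves_not hmin h3
  refine (hf.corner_low_or_high hv hmin h1).resolve_right fun ⟨hhigh, hhigh'⟩ => ?_
  rw [Bool.not_not] at h3 h4
  have hle := payoff_mix_le_of_high hv h2 h3 h4 hhigh hhigh'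
  simp only [Bool.not_not, Nat.add_assoc, Nat.reduceAdd] at h1 h2 h3 h4 hhigh hhigh' hle
  have hge := hlow.le_payoff_mix hv h h1 h2
  have hl := conv_mix_left (!q) (f (k + 1)) (f (k + 3))
  have hr := conv_mix_right (!q) (f (k + 1)) (f (k + 3))
  have hl' := conv_mix_left q (f (k + 2)) (f (k + 4))
  have hr' := conv_mix_right q (f (k + 2)) (f (k + 4))
  rw [Bool.not_not] at hl
  have hconf := hv.confluence (p := !q) (w := mix (!q) (f (k + 1)) (f (k + 3)))
    (x := f (k + 4)) (y := mix q (f (k + 2)) (f (k + 4))) (z := f (k + 1))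
    ⟨hr.trans h3.1, hlow.2.trans_lt h3.2⟩
    (by rw [Bool.not_not]; exact ⟨hr'.symm, h4.2.trans_le hhigh⟩)
    (by rw [Bool.not_not]; exact ⟨hl.symm, hlow.1.trans_lt h.2⟩)
    ⟨h1.1.trans hl', h1.2.trans_le hhigh'⟩
  rw [Bool.not_not] at hconf
  exact absurd h2.2 (not_lt.mpr (hge.trans (hconf.trans hle)))

/-- A game without forbidden patterns has no closed walk of improvements. -/
theorem NoForbiddenPattern.not_closedWalk (hv : NoForbiddenPattern v) (n : ℕ)
    (f : ℕ → Sa × Sb) : ¬ ClosedWalk (Improvement v) n f := by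
  induction n using Nat.strong_induction_on generalizing f with
  | _ n ih =>
    intro hf
    have hmin : ∀ m < n, ¬ ∃ g, ClosedWalk (Improvement v) m g := fun m hm ⟨g, hg⟩ => ih m hm g hg
    by_cases hlow : ∃ k q, Improves v q (f k) (f (k + 1)) ∧ LowCorner v f q k
    · obtain ⟨k, q, h0, h0'⟩ := hlow
      have hall : ∀ j, Improves v q (f (k + 2 * j)) (f (k + 2 * j + 1)) ∧
          LowCorner v f q (k + 2 * j) := by
        intro j
        induction j with
        | zero => exact ⟨h0, h0'⟩
        | succ j ihj =>
          have h1 := hf.improves_not hmin ihj.1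
          have h2 := hf.improves_not hmin h1
          have hl := (ihj.2.succ hv hf hmin ihj.1).succ hv hf hmin h1
          rw [Bool.not_not] at h2 hl
          exact ⟨h2, hl⟩
      obtain ⟨j, hj⟩ := hf.exists_le_payoff (v := v) q k
      obtain ⟨h, hl⟩ := hall j
      have h1 := hf.improves_not hmin h
      have h2 := hf.improves_not hmin h1
      rw [Bool.not_not] at h2
      exact absurd h2.2 (not_lt.mpr (((hl.le_payoff_mix hv h h1 h2).trans hl.1).trans hj))
    · obtain ⟨q, h0⟩ := hf.2.2 0
      have hall : ∀ j, Improves v q (f (2 * j)) (f (2 * j + 1)) := by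
        intro j
        induction j with
        | zero => exact h0
        | succ j ihj =>
          have h2 := hf.improves_not hmin (hf.improves_not hmin ihj)
          rwa [Bool.not_not] at h2
      obtain ⟨j, hj⟩ := hf.exists_le_payoff (v := v) (!q) 1
      have h := hall j
      have h1 := hf.improves_not hmin h
      have h2 := hf.improves_not hmin h1
      have h3 := hf.improves_not hmin h2
      rw [Bool.not_not] at h2 h3
      have hhigh := (hf.corner_low_or_high hv hmin h).resolve_left fun hl => hlow ⟨_, q, h, hl⟩
      have hle := payoff_mix_le_of_high hv h1 h2 h3 hhigh.1 hhigh.2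
      rw [Nat.add_comm 1] at hj
      exact absurd h3.2 (not_lt.mpr ((hhigh.1.trans hle).trans hj))

end Termination

/-- A continuous function on a product of compact spaces is uniformly approximated by replacing
the first argument with one of finitely many representatives. -/
theorem exists_finite_range_dist_lt {X Y E : Type*} [TopologicalSpace X] [TopologicalSpace Y]
    [CompactSpace X] [CompactSpace Y] [PseudoMetricSpace E] {v : X × Y → E} (hv : Continuous v)
    {δ : ℝ} (hδ : 0 < δ) :
    ∃ r : X → X, (Set.range r).Finite ∧ ∀ x y, dist (v (x, y)) (v (r x, y)) < δ := by
  let F : C(X, C(Y, E)) := ContinuousMap.curry ⟨v, hv⟩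
  obtain ⟨t, ht⟩ := CompactSpace.elim_nhds_subcover (fun x => F ⁻¹' Metric.ball (F x) δ)
    fun x => F.continuous.continuousAt (Metric.ball_mem_nhds _ hδ)
  have hex : ∀ x, ∃ x' ∈ t, dist (F x) (F x') < δ := by
    intro x
    have hx : x ∈ (⊤ : Set X) := trivial
    rw [← ht] at hx
    simpa using hx
  choose r hrt hr using hex
  refine ⟨r, t.finite_toSet.subset (Set.range_subset_iff.mpr hrt), fun x y => ?_⟩
  exact (ContinuousMap.dist_apply_le_dist (f := F x) (g := F (r x)) y).trans_lt (hr x)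

theorem abs_payoff_sub_le_dist {Sa Sb : Type*} (v : Sa × Sb → ℝ × ℝ) (p : Bool)
    (s s' : Sa × Sb) : |payoff v p s - payoff v p s'| ≤ dist (v s) (v s') := by
  rw [← Real.dist_eq, Prod.dist_eq]
  cases p
  · exact le_max_right _ _
  · exact le_max_left _ _

theorem statement8 {Sa Sb : Type*} [TopologicalSpace Sa] [TopologicalSpace Sb]
    [CompactSpace Sa] [CompactSpace Sb]
    (v : Sa × Sb → ℝ × ℝ) (hv : Continuous v)
    (hforb : ∀ (p : Bool) (w x y z : Sa × Sb),
      ¬ (IsEC v (fun o o' : ℝ × ℝ => o.1 < o'.1) (fun o o' : ℝ × ℝ => o.2 < o'.2) p w x y z ∨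
         IsPUB v (fun o o' : ℝ × ℝ => o.1 < o'.1) (fun o o' : ℝ × ℝ => o.2 < o'.2) p w x y z ∨
         IsPUC v (fun o o' : ℝ × ℝ => o.1 < o'.1) (fun o o' : ℝ × ℝ => o.2 < o'.2) p w x y z))
    (ε : ℝ) (hε : 0 < ε) :
    ¬ ∃ f : ℕ → Sa × Sb, ∀ n, ∃ p, EImpr v ε p (f n) (f (n + 1)) := by
  rintro ⟨f, hf⟩
  obtain ⟨ra, hra, hda⟩ := exists_finite_range_dist_lt hv (show 0 < ε / 4 by positivity)
  obtain ⟨rb, hrb, hdb⟩ :=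
    exists_finite_range_dist_lt (hv.comp continuous_swap) (show 0 < ε / 4 by positivity)
  let R : Sa × Sb → Sa × Sb := Prod.map ra rb
  have hR : (Set.range R).Finite := by
    rw [Set.range_prodMap]
    exact hra.prod hrb
  have hdist : ∀ s, dist (v s) (v (R s)) < ε / 2 := fun s => by
    have h1 := hda s.1 s.2
    have h2 := hdb s.2 (ra s.1)
    have h3 := dist_triangle (v s) (v (ra s.1, s.2)) (v (R s))
    have h4 : dist (v (ra s.1, s.2)) (v (R s)) < ε / 4 := h2
    have h5 : dist (v s) (v (ra s.1, s.2)) < ε / 4 := h1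
    linarith
  have hstep : ∀ k, Improvement v (R (f k)) (R (f (k + 1))) := fun k => by
    obtain ⟨p, hconv, hp⟩ := hf k
    refine ⟨p, ?_, ?_⟩
    · cases p
      · exact congrArg ra hconv
      · exact congrArg rb hconv
    have hlt : payoff v p (f k) + ε < payoff v p (f (k + 1)) := by cases p <;> exact hp
    have h1 := (abs_le.mp ((abs_payoff_sub_le_dist v p _ _).trans (hdist (f k)).le)).1
    have h2 := (abs_le.mp ((abs_payoff_sub_le_dist v p _ _).trans (hdist (f (k + 1))).le)).2
    linarith
  obtain ⟨i, -, j, -, hij, heq⟩ := Set.infinite_univ.exists_lt_map_eq_of_mapsTo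
    (f := fun k => R (f k)) (fun k _ => Set.mem_range_self (f k)) hR
  obtain ⟨g, hg⟩ := exists_closedWalk_of_eq (S := Improvement v) (Nat.sub_pos_of_lt hij)
    (fun k => R (f (i + k))) (fun k _ => hstep (i + k))
    (by simpa [Nat.add_sub_cancel' hij.le] using heq.symm)
  exact NoForbiddenPattern.not_closedWalk hforb _ g hg
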